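/- Let 1 ≤ p < ∞ and, for each dimension d ≥ 1, consider the dimension-dependent weights γ_u = d^{−|u|} for u ⊆ [d]. Then there exists a constant c > 0, independent of d, such that for every d ≥ 1 and every C^∞ function f : ℝ^d → ℂ one has ‖f‖_{A,d,p} ≤ c ‖f‖_{⊤,d,p} and ‖f‖_{⊤,d,p} ≤ c ‖f‖_{A,d,p}. -/

import Mathlib

open MeasureTheory

/-- Partial derivative in direction `j`. -/
noncomputable def pderiv {d : ℕ} (j : Fin d) (f : (Fin d → ℝ) → ℂ) : (Fin d → ℝ) → ℂ :=
  fun x => fderiv ℝ f x (Pi.single j 1)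

/-- First-order mixed partial derivative `f^{(u)} = (∏_{j∈u} ∂/∂x_j) f`. -/
noncomputable def mderiv {d : ℕ} (u : Finset (Fin d)) (f : (Fin d → ℝ) → ℂ) : (Fin d → ℝ) → ℂ :=
  u.toList.foldr pderiv f

/-- The unit cube `[0,1]^d`. -/
def cube (d : ℕ) : Set (Fin d → ℝ) := Set.univ.pi fun _ => Set.Icc 0 1

/-- The point `(x_u; t_{u^c})`: `j`-th coordinate is `x j` for `j ∈ u` and `t j` otherwise. -/
def combine {d : ℕ} (u : Finset (Fin d)) (x t : Fin d → ℝ) : Fin d → ℝ :=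
  fun j => if j ∈ u then x j else t j

/-- `‖f‖_{⊤,d,p}^p`: the `p`-th power of the anchored norm. Since the integrand depends only
on the coordinates in `u` and the cube carries a probability measure, the integral over
`[0,1]^u` is written as an integral over the whole cube. -/
noncomputable def anchP {d : ℕ} (γ : Finset (Fin d) → ℝ) (p : ℝ) (f : (Fin d → ℝ) → ℂ) : ℝ :=
  ∑ u : Finset (Fin d), γ u ^ (-p) * ∫ x in cube d, ‖mderiv u f (combine u x 0)‖ ^ p

/-- `‖f‖_{A,d,p}^p`: the `p`-th power of the ANOVA norm. -/
noncomputable def anovaP {d : ℕ} (γ : Finset (Fin d) → ℝ) (p : ℝ) (f : (Fin d → ℝ) → ℂ) : ℝ :=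
  ∑ u : Finset (Fin d), γ u ^ (-p) *
    ∫ x in cube d, ‖∫ t in cube d, mderiv u f (combine u x t)‖ ^ p

/-- The anchored norm `‖f‖_{⊤,d,p}`. -/
noncomputable def anchNorm {d : ℕ} (γ : Finset (Fin d) → ℝ) (p : ℝ) (f : (Fin d → ℝ) → ℂ) : ℝ :=
  anchP γ p f ^ (1 / p)

/-- The ANOVA norm `‖f‖_{A,d,p}`. -/
noncomputable def anovaNorm {d : ℕ} (γ : Finset (Fin d) → ℝ) (p : ℝ) (f : (Fin d → ℝ) → ℂ) : ℝ :=
  anovaP γ p f ^ (1 / p)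

lemma contDiff_pderiv {d : ℕ} (j : Fin d) {f : (Fin d → ℝ) → ℂ} (hf : ContDiff ℝ (⊤ : ℕ∞) f) :
    ContDiff ℝ (⊤ : ℕ∞) (pderiv j f) := by
  unfold pderiv
  exact (hf.fderiv_right (m := ((⊤ : ℕ∞) : WithTop ℕ∞)) (by simp)).clm_apply contDiff_const

lemma pderiv_comm {d : ℕ} (i j : Fin d) {f : (Fin d → ℝ) → ℂ} (hf : ContDiff ℝ (⊤ : ℕ∞) f) :
    pderiv i (pderiv j f) = pderiv j (pderiv i f) := by
  have hd : Differentiable ℝ (fderiv ℝ f) :=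
    (hf.fderiv_right (m := ((⊤ : ℕ∞) : WithTop ℕ∞)) (by simp)).differentiable (by simp)
  have key : ∀ i j : Fin d, ∀ x, pderiv i (pderiv j f) x
      = fderiv ℝ (fderiv ℝ f) x (Pi.single i 1) (Pi.single j 1) := by
    intro i j x
    unfold pderiv
    rw [fderiv_clm_apply (hd x) (differentiableAt_const _)]
    simp
  funext x
  rw [key, key]
  have hs : IsSymmSndFDerivAt ℝ f x :=
    hf.contDiffAt.isSymmSndFDerivAt (by
      rw [minSmoothness_of_isRCLikeNormedField]
      exact WithTop.coe_le_coe.2 (le_top : (2 : ℕ∞) ≤ ⊤))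
  exact hs _ _

lemma contDiff_foldr {d : ℕ} (l : List (Fin d)) {f : (Fin d → ℝ) → ℂ}
    (hf : ContDiff ℝ (⊤ : ℕ∞) f) : ContDiff ℝ (⊤ : ℕ∞) (l.foldr pderiv f) := by
  induction l with
  | nil => exact hf
  | cons a l ih => exact contDiff_pderiv a ih

lemma foldr_perm {d : ℕ} {l l' : List (Fin d)} (h : l.Perm l') {f : (Fin d → ℝ) → ℂ}
    (hf : ContDiff ℝ (⊤ : ℕ∞) f) : l.foldr pderiv f = l'.foldr pderiv f := by
  induction h with
  | nil => rfl
  | cons a _ ih => simp only [List.foldr_cons, ih]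
  | swap a b l => simpa only [List.foldr_cons] using pderiv_comm b a (contDiff_foldr l hf)
  | trans _ _ h1 h2 => exact h1.trans h2

lemma contDiff_mderiv {d : ℕ} (u : Finset (Fin d)) {f : (Fin d → ℝ) → ℂ}
    (hf : ContDiff ℝ (⊤ : ℕ∞) f) : ContDiff ℝ (⊤ : ℕ∞) (mderiv u f) :=
  contDiff_foldr _ hf

lemma mderiv_insert {d : ℕ} {j : Fin d} {u : Finset (Fin d)} (hj : j ∉ u) {f : (Fin d → ℝ) → ℂ}
    (hf : ContDiff ℝ (⊤ : ℕ∞) f) : mderiv (insert j u) f = pderiv j (mderiv u f) := by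
  unfold mderiv
  rw [foldr_perm (Finset.toList_insert hj) hf]
  rfl

/-- Mixed point: `x` on `u`, `0` on `S \ u`, `t` elsewhere. -/
def mixPt {d : ℕ} (S u : Finset (Fin d)) (x t : Fin d → ℝ) : Fin d → ℝ :=
  fun k => if k ∈ u then x k else if k ∈ S then 0 else t k

/-- Hybrid term: anchored on `S`, averaged elsewhere. -/
noncomputable def hyb {d : ℕ} (S u : Finset (Fin d)) (f : (Fin d → ℝ) → ℂ) (x : Fin d → ℝ) : ℂ :=
  ∫ t in cube d, mderiv u f (mixPt S u x t)

lemma isCompact_cube (d : ℕ) : IsCompact (cube d) :=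
  isCompact_univ_pi fun _ => isCompact_Icc

lemma restrict_cube (d : ℕ) : (volume.restrict (cube d) : Measure (Fin d → ℝ)) =
    Measure.pi (fun _ => volume.restrict (Set.Icc (0:ℝ) 1)) := by
  rw [cube, volume_pi, Measure.restrict_pi_pi]

instance probIcc : IsProbabilityMeasure (volume.restrict (Set.Icc (0:ℝ) 1)) :=
  ⟨by simp⟩

instance probCube (d : ℕ) : IsProbabilityMeasure (volume.restrict (cube d)) := by
  rw [restrict_cube]; infer_instance

lemma continuous_mixPt {d : ℕ} (S u : Finset (Fin d)) :
    Continuous (fun q : (Fin d → ℝ) × (Fin d → ℝ) => mixPt S u q.1 q.2) := by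
  refine continuous_pi fun k => ?_
  unfold mixPt
  split_ifs <;> fun_prop

lemma continuous_hyb {d : ℕ} (S u : Finset (Fin d)) {f : (Fin d → ℝ) → ℂ}
    (hf : ContDiff ℝ (⊤ : ℕ∞) f) : Continuous (hyb S u f) := by
  unfold hyb
  refine continuous_parametric_integral_of_continuous ?_ (isCompact_cube d)
  exact (contDiff_mderiv u hf).continuous.comp (continuous_mixPt S u)

lemma resample_mp {d : ℕ} (j : Fin d) :
    MeasurePreserving (fun q : (Fin d → ℝ) × ℝ => Function.update q.1 j q.2)
      ((volume.restrict (cube d)).prod (volume.restrict (Set.Icc (0:ℝ) 1)))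
      (volume.restrict (cube d)) := by
  have hm : Measurable (fun q : (Fin d → ℝ) × ℝ => Function.update q.1 j q.2) :=
    (show Continuous (fun q : (Fin d → ℝ) × ℝ => Function.update q.1 j q.2) by fun_prop).measurable
  refine ⟨hm, ?_⟩
  rw [restrict_cube]
  symm
  refine Measure.pi_eq fun s hs => ?_
  rw [Measure.map_apply hm (MeasurableSet.univ_pi hs)]
  have : (fun q : (Fin d → ℝ) × ℝ => Function.update q.1 j q.2) ⁻¹' (Set.univ.pi s)
      = (Set.univ.pi (Function.update s j Set.univ)) ×ˢ (s j) := by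
    ext ⟨t, r⟩
    simp only [Set.mem_preimage, Set.mem_pi, Set.mem_univ, true_implies, Set.mem_prod]
    constructor
    · intro h
      refine ⟨fun k => ?_, by simpa using h j⟩
      by_cases hk : k = j
      · subst hk; simp
      · simpa [hk] using h k
    · rintro ⟨h, h'⟩ k
      by_cases hk : k = j
      · subst hk; simpa using h'
      · simpa [hk] using h k
  rw [this, Measure.prod_prod, Measure.pi_pi, ← Finset.mul_prod_erase _ _ (Finset.mem_univ j),
    ← Finset.mul_prod_erase _ (fun i => (volume.restrict (Set.Icc (0:ℝ) 1)) (s i))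
      (Finset.mem_univ j), mul_comm]
  congr 1
  rw [Function.update_self, measure_univ, one_mul]
  refine Finset.prod_congr rfl fun k hk => ?_
  rw [Function.update_of_ne (Finset.ne_of_mem_erase hk)]

lemma integrable_prod_cont {d : ℕ} {E : Type*} [NormedAddCommGroup E] {F : (Fin d → ℝ) × ℝ → E} (hF : Continuous F) :
    Integrable F ((volume.restrict (cube d)).prod (volume.restrict (Set.Icc (0:ℝ) 1))) := by
  rw [Measure.prod_restrict]
  exact hF.continuousOn.integrableOn_compact ((isCompact_cube d).prod isCompact_Icc)

lemma resample {d : ℕ} (j : Fin d) {E : Type*} [NormedAddCommGroup E] [NormedSpace ℝ E]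
    {F : (Fin d → ℝ) → E} (hF : Continuous F) :
    ∫ t in cube d, F t = ∫ t in cube d, ∫ s in Set.Icc (0:ℝ) 1, F (Function.update t j s) := by
  have h1 : Continuous (fun q : (Fin d → ℝ) × ℝ => F (Function.update q.1 j q.2)) := by fun_prop
  rw [integral_integral (f := fun t s => F (Function.update t j s)) (integrable_prod_cont h1)]
  have h2 := integral_map (μ := (volume.restrict (cube d)).prod (volume.restrict (Set.Icc (0:ℝ) 1)))
    (resample_mp j).measurable.aemeasurable (f := F) (by
      rw [(resample_mp j).map_eq]
      exact (hF.continuousOn.integrableOn_compact (isCompact_cube d)).aestronglyMeasurable)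
  rw [(resample_mp j).map_eq] at h2
  exact h2

lemma one_dim {φ φ' : ℝ → ℂ} (h : ∀ r, HasDerivAt φ (φ' r) r) (hc : Continuous φ') :
    (∫ s in Set.Icc (0:ℝ) 1, φ s) - φ 0 = ∫ r in Set.Icc (0:ℝ) 1, ((1 - r : ℝ) : ℂ) * φ' r := by
  have hφ : Continuous φ := continuous_iff_continuousAt.2 fun r => (h r).continuousAt
  rw [integral_Icc_eq_integral_Ioc, integral_Icc_eq_integral_Ioc,
    ← intervalIntegral.integral_of_le zero_le_one, ← intervalIntegral.integral_of_le zero_le_one]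
  have hc2 : Continuous (fun r : ℝ => ((1 - r : ℝ) : ℂ) * φ' r) := by fun_prop
  have hd : ∀ r ∈ Set.uIcc (0:ℝ) 1, HasDerivAt (fun r : ℝ => ((1 - r : ℝ) : ℂ) * φ r)
      (((1 - r : ℝ) : ℂ) * φ' r - φ r) r := by
    intro r _
    have h1 : HasDerivAt (fun r : ℝ => ((1 - r : ℝ) : ℂ)) (((-1 : ℝ)) : ℂ) r :=
      ((hasDerivAt_id r).const_sub 1).ofReal_comp
    have := h1.mul (h r)
    refine this.congr_deriv ?_
    simp only [Complex.ofReal_neg, Complex.ofReal_one]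
    ring
  have := intervalIntegral.integral_eq_sub_of_hasDerivAt hd ((hc2.sub hφ).intervalIntegrable _ _)
  rw [intervalIntegral.integral_sub (hc2.intervalIntegrable _ _) (hφ.intervalIntegrable _ _)] at this
  simp only [sub_self, sub_zero, Complex.ofReal_zero, Complex.ofReal_one, zero_mul, one_mul] at this
  linear_combination -this

lemma hasDerivAt_comp_update {d : ℕ} (j : Fin d) {g : (Fin d → ℝ) → ℂ} (hg : ContDiff ℝ (⊤ : ℕ∞) g)
    (y : Fin d → ℝ) (r : ℝ) :
    HasDerivAt (fun s => g (Function.update y j s)) (pderiv j g (Function.update y j r)) r := by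
  have h1 : HasFDerivAt g (fderiv ℝ g (Function.update y j r)) (Function.update y j r) :=
    (hg.differentiable (by simp) _).hasFDerivAt
  exact h1.comp_hasDerivAt r (hasDerivAt_update y j r)

lemma hyb_diff {d : ℕ} {S u : Finset (Fin d)} {j : Fin d} (hS : j ∉ S) (hu : j ∉ u)
    {f : (Fin d → ℝ) → ℂ} (hf : ContDiff ℝ (⊤ : ℕ∞) f) (x : Fin d → ℝ) :
    ‖hyb S u f x - hyb (insert j S) u f x‖ ≤
      ∫ r in Set.Icc (0:ℝ) 1, ‖hyb S (insert j u) f (Function.update x j r)‖ := by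
  have hg := contDiff_mderiv u hf
  have hg' : Continuous (pderiv j (mderiv u f)) := (contDiff_pderiv j hg).continuous
  have hgc := hg.continuous
  have hP : Continuous (mixPt S u x) :=
    (continuous_mixPt S u).comp (continuous_const.prodMk continuous_id)
  have e1 : ∀ t, mixPt (insert j S) u x t = Function.update (mixPt S u x t) j 0 := by
    intro t; funext k
    by_cases hk : k = j
    · subst hk; simp [mixPt, hu]
    · simp [mixPt, hk]
  have e2 : ∀ t s, mixPt S u x (Function.update t j s) = Function.update (mixPt S u x t) j s := by
    intro t s; funext k
    by_cases hk : k = j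
    · subst hk; simp [mixPt, hu, hS]
    · simp [mixPt, hk]
  have e3 : ∀ t s, mixPt S (insert j u) (Function.update x j s) t
      = Function.update (mixPt S u x t) j s := by
    intro t s; funext k
    by_cases hk : k = j
    · subst hk; simp [mixPt]
    · simp [mixPt, hk]
  have hA : Continuous (fun q : (Fin d → ℝ) × ℝ =>
      mderiv u f (Function.update (mixPt S u x q.1) j q.2)) := by fun_prop
  have hB : Continuous (fun q : (Fin d → ℝ) × ℝ => ((1 - q.2 : ℝ) : ℂ) *
      pderiv j (mderiv u f) (Function.update (mixPt S u x q.1) j q.2)) := by fun_prop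
  have h1 : hyb S u f x - hyb (insert j S) u f x
      = ∫ t in cube d, ∫ r in Set.Icc (0:ℝ) 1, ((1 - r : ℝ) : ℂ) *
          pderiv j (mderiv u f) (Function.update (mixPt S u x t) j r) := by
    unfold hyb
    rw [resample j (F := fun t => mderiv u f (mixPt S u x t)) (by fun_prop)]
    simp only [e1, e2]
    rw [← integral_sub]
    · refine integral_congr_ae (Filter.Eventually.of_forall fun t => ?_)
      exact one_dim (fun r => hasDerivAt_comp_update j hg (mixPt S u x t) r) (by fun_prop)
    · exact (integrable_prod_cont hA).integral_prod_left
    · refine ContinuousOn.integrableOn_compact (isCompact_cube d) (Continuous.continuousOn ?_)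
      fun_prop
  rw [h1, integral_integral_swap (integrable_prod_cont hB)]
  refine norm_integral_le_of_norm_le ?_ ?_
  · refine Continuous.integrableOn_Icc ?_
    have := continuous_hyb S (insert j u) hf
    fun_prop
  · refine (ae_restrict_iff' measurableSet_Icc).2 (Filter.Eventually.of_forall fun r hr => ?_)
    rw [integral_const_mul, norm_mul]
    unfold hyb
    rw [mderiv_insert hu hf]
    simp only [e3]
    refine mul_le_of_le_one_left (norm_nonneg _) ?_
    rw [Complex.norm_real, Real.norm_eq_abs, abs_le]
    constructor <;> linarith [hr.1, hr.2]

lemma hyb_mem {d : ℕ} {S u : Finset (Fin d)} {j : Fin d} (hu : j ∈ u)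
    (f : (Fin d → ℝ) → ℂ) : hyb (insert j S) u f = hyb S u f := by
  funext x
  unfold hyb
  congr 1
  funext t
  congr 1
  funext k
  by_cases hk : k = j
  · subst hk; simp [mixPt, hu]
  · simp [mixPt, hk]

lemma jensen_two {p ε a b : ℝ} (hp : 1 ≤ p) (hε : 0 < ε) (ha : 0 ≤ a) (hb : 0 ≤ b) :
    (a + ε * b) ^ p ≤ (1 + ε) ^ (p - 1) * (a ^ p + ε * b ^ p) := by
  have h := (convexOn_rpow hp).2 (Set.mem_Ici.2 ha) (Set.mem_Ici.2 hb)
    (show 0 ≤ 1 / (1 + ε) by positivity) (show 0 ≤ ε / (1 + ε) by positivity) (by field_simp)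
  simp only [smul_eq_mul] at h
  have e1 : a + ε * b = (1 + ε) * (1 / (1 + ε) * a + ε / (1 + ε) * b) := by field_simp
  rw [e1, Real.mul_rpow (by positivity) (by positivity)]
  calc _ ≤ (1 + ε) ^ p * (1 / (1 + ε) * a ^ p + ε / (1 + ε) * b ^ p) := by gcongr
    _ = _ := by
      rw [Real.rpow_sub_one (by positivity)]
      field_simp

lemma jensen_int {p : ℝ} (hp : 1 ≤ p) {h : ℝ → ℝ} (hc : Continuous h) (h0 : ∀ r, 0 ≤ h r) :
    (∫ r in Set.Icc (0:ℝ) 1, h r) ^ p ≤ ∫ r in Set.Icc (0:ℝ) 1, h r ^ p := by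
  have hcp : Continuous (fun r => h r ^ p) := hc.rpow_const fun _ => Or.inr (by linarith)
  exact (convexOn_rpow hp).map_integral_le
    (Real.continuous_rpow_const (by linarith)).continuousOn isClosed_Ici
    (Filter.Eventually.of_forall h0) hc.integrableOn_Icc hcp.integrableOn_Icc

/-- generic one-term bound -/
lemma term_bound {d : ℕ} {p ε : ℝ} (hp : 1 ≤ p) (hε : 0 < ε) (j : Fin d)
    {A B H : (Fin d → ℝ) → ℂ} (hA : Continuous A) (hB : Continuous B) (hH : Continuous H)
    (h : ∀ x, ‖A x - B x‖ ≤ ∫ r in Set.Icc (0:ℝ) 1, ‖H (Function.update x j r)‖) :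
    ∫ x in cube d, ‖B x‖ ^ p ≤ (1 + ε) ^ (p - 1) *
      ((∫ x in cube d, ‖A x‖ ^ p) + ε * (ε⁻¹ ^ p * ∫ x in cube d, ‖H x‖ ^ p)) := by
  have hp0 : 0 ≤ p := by linarith
  have cp : ∀ {F : (Fin d → ℝ) → ℂ}, Continuous F → Continuous (fun x => ‖F x‖ ^ p) :=
    fun hF => hF.norm.rpow_const fun _ => Or.inr hp0
  have hHp := cp hH
  have ii : ∀ {F : (Fin d → ℝ) → ℝ}, Continuous F → IntegrableOn F (cube d) :=
    fun hF => hF.continuousOn.integrableOn_compact (isCompact_cube d)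
  have hK : Integrable (fun x => ∫ r in Set.Icc (0:ℝ) 1, ‖H (Function.update x j r)‖ ^ p)
      (volume.restrict (cube d)) := by
    have hF : Continuous (fun q : (Fin d → ℝ) × ℝ => ‖H (Function.update q.1 j q.2)‖ ^ p) :=
      hHp.comp (by fun_prop : Continuous (fun q : (Fin d → ℝ) × ℝ => Function.update q.1 j q.2))
    exact (integrable_prod_cont hF).integral_prod_left
  rw [resample j hHp]
  have hAi := ii (cp hA)
  rw [← integral_const_mul (ε⁻¹ ^ p), ← integral_const_mul ε, ← integral_add hAi
    ((hK.const_mul _).const_mul _), ← integral_const_mul]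
  refine integral_mono (ii (cp hB)) ((hAi.add ((hK.const_mul _).const_mul _)).const_mul _) ?_
  intro x
  have hK0 : 0 ≤ ∫ r in Set.Icc (0:ℝ) 1, ‖H (Function.update x j r)‖ :=
    integral_nonneg fun _ => norm_nonneg _
  have h1 : ‖B x‖ ≤ ‖A x‖ + ε * (ε⁻¹ * ∫ r in Set.Icc (0:ℝ) 1, ‖H (Function.update x j r)‖) := by
    rw [mul_inv_cancel_left₀ hε.ne']
    have := norm_sub_norm_le (B x) (A x)
    rw [norm_sub_rev] at this
    linarith [h x]
  calc ‖B x‖ ^ p ≤ _ := Real.rpow_le_rpow (norm_nonneg _) h1 hp0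
    _ ≤ _ := jensen_two hp hε (norm_nonneg _) (by positivity)
    _ ≤ _ := by
      rw [Real.mul_rpow (by positivity) hK0]
      have := jensen_int hp (h := fun r => ‖H (Function.update x j r)‖) (by fun_prop)
        (fun _ => norm_nonneg _)
      dsimp only
      gcongr

/-- Hybrid norm to the `p`. -/
noncomputable def hybP {d : ℕ} (p : ℝ) (S : Finset (Fin d)) (f : (Fin d → ℝ) → ℂ) : ℝ :=
  ∑ u : Finset (Fin d), (((d : ℝ)⁻¹) ^ u.card) ^ (-p) * ∫ x in cube d, ‖hyb S u f x‖ ^ p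

lemma sum_step {d : ℕ} (hd : 1 ≤ d) {p : ℝ} (hp : 1 ≤ p) (j : Fin d)
    (a b : Finset (Fin d) → ℝ) (ha : ∀ u, 0 ≤ a u)
    (h1 : ∀ u, j ∈ u → b u = a u)
    (h2 : ∀ u, j ∉ u → b u ≤ (1 + (d:ℝ)⁻¹) ^ (p - 1) *
      (a u + (d:ℝ)⁻¹ * ((d:ℝ)⁻¹⁻¹ ^ p * a (insert j u)))) :
    ∑ u : Finset (Fin d), (((d : ℝ)⁻¹) ^ u.card) ^ (-p) * b u ≤
      (1 + (d:ℝ)⁻¹) ^ p * ∑ u : Finset (Fin d), (((d : ℝ)⁻¹) ^ u.card) ^ (-p) * a u := by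
  have hd0 : (0:ℝ) < d := by exact_mod_cast hd
  set w : Finset (Fin d) → ℝ := fun u => (((d : ℝ)⁻¹) ^ u.card) ^ (-p) with hw
  have hw0 : ∀ u, 0 ≤ w u := fun u => by positivity
  have hC : 1 ≤ (1 + (d:ℝ)⁻¹) ^ (p - 1) :=
    Real.one_le_rpow (by linarith [inv_pos.2 hd0]) (by linarith)
  set C := (1 + (d:ℝ)⁻¹) ^ (p - 1) with hCdef
  have hwi : ∀ u, j ∉ u → w (insert j u) = w u * (d:ℝ)⁻¹⁻¹ ^ p := by
    intro u hu
    simp only [hw]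
    rw [Finset.card_insert_of_notMem hu, pow_succ, Real.mul_rpow (by positivity) (by positivity),
      Real.rpow_neg (x := (d:ℝ)⁻¹) (by positivity), Real.inv_rpow (x := (d:ℝ)⁻¹) (by positivity)]
  have hterm : ∀ u, w u * b u ≤
      C * (w u * a u + (d:ℝ)⁻¹ * (if j ∉ u then w (insert j u) * a (insert j u) else 0)) := by
    intro u
    by_cases hu : j ∈ u
    · simp only [hu, not_true, if_false, mul_zero, add_zero, h1 u hu]
      exact le_mul_of_one_le_left (mul_nonneg (hw0 u) (ha u)) hC
    · simp only [hu, not_false_iff, if_true, hwi u hu]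
      refine (mul_le_mul_of_nonneg_left (h2 u hu) (hw0 u)).trans (le_of_eq ?_)
      ring
  have hshift : ∑ u : Finset (Fin d), (if j ∉ u then w (insert j u) * a (insert j u) else 0)
      ≤ ∑ u : Finset (Fin d), w u * a u := by
    rw [← Finset.sum_filter]
    rw [← Finset.sum_image (f := fun u => w u * a u) (g := fun u => insert j u)]
    · exact Finset.sum_le_sum_of_subset_of_nonneg (Finset.subset_univ _)
        fun u _ _ => mul_nonneg (hw0 u) (ha u)
    · intro u hu v hv huv
      simp only [Finset.coe_filter, Finset.mem_univ, true_and, Set.mem_ofPred_eq] at hu hv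
      have := congrArg (fun s => s.erase j) huv
      simpa [hu, hv] using this
  calc _ ≤ ∑ u, C * (w u * a u + (d:ℝ)⁻¹ *
        (if j ∉ u then w (insert j u) * a (insert j u) else 0)) :=
        Finset.sum_le_sum fun u _ => hterm u
    _ = C * (∑ u, w u * a u + (d:ℝ)⁻¹ *
        ∑ u, (if j ∉ u then w (insert j u) * a (insert j u) else 0)) := by
        rw [← Finset.mul_sum, Finset.sum_add_distrib, Finset.mul_sum]
    _ ≤ C * (∑ u, w u * a u + (d:ℝ)⁻¹ * ∑ u, w u * a u) := by gcongr
    _ = _ := by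
        have : (1 + (d:ℝ)⁻¹) ^ p = C * (1 + (d:ℝ)⁻¹) := by
          rw [hCdef, Real.rpow_sub_one (by positivity)]; field_simp
        rw [this]; ring

lemma hybP_step {d : ℕ} (hd : 1 ≤ d) {p : ℝ} (hp : 1 ≤ p) {S : Finset (Fin d)} {j : Fin d}
    (hS : j ∉ S) {f : (Fin d → ℝ) → ℂ} (hf : ContDiff ℝ (⊤ : ℕ∞) f) :
    hybP p S f ≤ (1 + (d:ℝ)⁻¹) ^ p * hybP p (insert j S) f ∧
    hybP p (insert j S) f ≤ (1 + (d:ℝ)⁻¹) ^ p * hybP p S f := by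
  have hd0 : (0:ℝ) < (d:ℝ)⁻¹ := by
    have : (0:ℝ) < d := by exact_mod_cast hd
    positivity
  have hc := fun S u => continuous_hyb (d := d) S u hf
  constructor
  · refine sum_step hd hp j _ _ (fun u => by positivity) (fun u hu => by rw [hyb_mem hu]) ?_
    intro u hu
    refine term_bound hp hd0 j (hc _ _) (hc _ _) (hc _ _) fun x => ?_
    rw [norm_sub_rev, hyb_mem (Finset.mem_insert_self j u)]
    exact hyb_diff hS hu hf x
  · refine sum_step hd hp j _ _ (fun u => by positivity) (fun u hu => by rw [hyb_mem hu]) ?_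
    intro u hu
    exact term_bound hp hd0 j (hc _ _) (hc _ _) (hc _ _) fun x => hyb_diff hS hu hf x

lemma hybP_all {d : ℕ} (hd : 1 ≤ d) {p : ℝ} (hp : 1 ≤ p)
    {f : (Fin d → ℝ) → ℂ} (hf : ContDiff ℝ (⊤ : ℕ∞) f) (S : Finset (Fin d)) :
    hybP p ∅ f ≤ ((1 + (d:ℝ)⁻¹) ^ p) ^ S.card * hybP p S f ∧
    hybP p S f ≤ ((1 + (d:ℝ)⁻¹) ^ p) ^ S.card * hybP p ∅ f := by
  induction S using Finset.induction_on with
  | empty => simp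
  | insert j S hj ih =>
    obtain ⟨h1, h2⟩ := hybP_step hd hp hj hf
    rw [Finset.card_insert_of_notMem hj]
    constructor
    · refine ih.1.trans ?_
      rw [pow_succ, mul_assoc]
      gcongr
    · refine h2.trans ?_
      rw [pow_succ', mul_assoc]
      gcongr
      exact ih.2

lemma hybP_empty {d : ℕ} (p : ℝ) (f : (Fin d → ℝ) → ℂ) :
    hybP p ∅ f = anovaP (fun u : Finset (Fin d) => ((d : ℝ)⁻¹) ^ u.card) p f := by
  unfold hybP anovaP hyb
  have : ∀ u x t, mixPt (d := d) ∅ u x t = combine u x t := by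
    intro u x t; funext k; simp [mixPt, combine]
  simp only [this]

lemma hybP_univ {d : ℕ} (p : ℝ) (f : (Fin d → ℝ) → ℂ) :
    hybP p Finset.univ f = anchP (fun u : Finset (Fin d) => ((d : ℝ)⁻¹) ^ u.card) p f := by
  unfold hybP anchP hyb
  have : ∀ u x t, mixPt (d := d) Finset.univ u x t = combine u x 0 := by
    intro u x t; funext k; simp [mixPt, combine]
  simp only [this, integral_const, probReal_univ, one_smul]

lemma root_bound {d : ℕ} (hd : 1 ≤ d) {p : ℝ} (hp : 1 ≤ p) {A B : ℝ} (hA : 0 ≤ A) (hB : 0 ≤ B)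
    (h : A ≤ ((1 + (d:ℝ)⁻¹) ^ p) ^ d * B) : A ^ (1 / p) ≤ Real.exp 1 * B ^ (1 / p) := by
  have hp0 : 0 < p := by linarith
  have hd0 : (0:ℝ) < d := by exact_mod_cast hd
  have h1 : (1 + (d:ℝ)⁻¹) ^ d ≤ Real.exp 1 := by
    calc (1 + (d:ℝ)⁻¹) ^ d ≤ (Real.exp ((d:ℝ)⁻¹)) ^ d := by
          gcongr
          rw [add_comm]; exact Real.add_one_le_exp _
      _ = Real.exp 1 := by
          rw [← Real.exp_nat_mul, mul_inv_cancel₀ hd0.ne']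
  have h2 : A ≤ (Real.exp 1) ^ p * B := by
    refine h.trans ?_
    rw [← Real.rpow_natCast, ← Real.rpow_mul (by positivity), mul_comm p,
      Real.rpow_mul (by positivity), Real.rpow_natCast]
    gcongr
  calc A ^ (1 / p) ≤ ((Real.exp 1) ^ p * B) ^ (1 / p) := by gcongr
    _ = _ := by
      rw [Real.mul_rpow (by positivity) hB, ← Real.rpow_mul (by positivity),
        mul_one_div_cancel hp0.ne', Real.rpow_one]

lemma hybP_nonneg {d : ℕ} (p : ℝ) (S : Finset (Fin d)) (f : (Fin d → ℝ) → ℂ) : 0 ≤ hybP p S f := by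
  unfold hybP
  positivity

/-- for the dimension-dependent weights `γ_u = d^{-|u|}`, the anchored and
ANOVA norms are uniformly equivalent in the dimension. -/
theorem uniform_equivalence_dimension_dependent (p : ℝ) (hp : 1 ≤ p) :
    ∃ c : ℝ, 0 < c ∧ ∀ d : ℕ, 1 ≤ d → ∀ f : (Fin d → ℝ) → ℂ, ContDiff ℝ (⊤ : ℕ∞) f →
      anovaNorm (fun u : Finset (Fin d) => ((d : ℝ)⁻¹) ^ u.card) p f ≤
        c * anchNorm (fun u : Finset (Fin d) => ((d : ℝ)⁻¹) ^ u.card) p f ∧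
      anchNorm (fun u : Finset (Fin d) => ((d : ℝ)⁻¹) ^ u.card) p f ≤
        c * anovaNorm (fun u : Finset (Fin d) => ((d : ℝ)⁻¹) ^ u.card) p f := by
  refine ⟨Real.exp 1, Real.exp_pos 1, fun d hd f hf => ?_⟩
  have h := hybP_all hd hp hf Finset.univ
  rw [Finset.card_univ, Fintype.card_fin] at h
  have n1 := hybP_nonneg p ∅ f
  have n2 := hybP_nonneg p Finset.univ f
  unfold anovaNorm anchNorm
  rw [← hybP_empty, ← hybP_univ]
  exact ⟨root_bound hd hp n1 n2 h.1, root_bound hd hp n2 n1 h.2⟩
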